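/- If P₈ is an affinely regular octagon in the plane (centered at the origin), then γ*(P₈) = 2(2−√2). -/

import Mathlib

open Pointwise Set

noncomputable section

def IsPacking (C X : Set (ℝ × ℝ)) : Prop :=
  X.Pairwise fun x y => Disjoint (interior (C + {x})) (interior (C + {y}))

def IsCovering (D X : Set (ℝ × ℝ)) : Prop :=
  ⋃ x ∈ X, (D + {x}) = Set.univ

def IsLattice2 (Λ : Set (ℝ × ℝ)) : Prop :=
  ∃ v w : ℝ × ℝ, LinearIndependent ℝ ![v, w] ∧
    Λ = {p | ∃ z₁ z₂ : ℤ, p = (z₁ : ℝ) • v + (z₂ : ℝ) • w}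

/-- γ*(C): the smallest `r > 0` for which some lattice `Λ` makes `C + Λ` a packing
and `rC + Λ` a covering of the plane. -/
def gammaStar (C : Set (ℝ × ℝ)) : ℝ :=
  sInf {r : ℝ | 0 < r ∧ ∃ Λ : Set (ℝ × ℝ),
    IsLattice2 Λ ∧ IsPacking C Λ ∧ IsCovering (r • C) Λ}


/-- The regular octagon inscribed in the unit circle, centered at the origin. -/
def regularOctagon : Set (ℝ × ℝ) :=
  convexHull ℝ {p : ℝ × ℝ | ∃ k : Fin 8,
    p = (Real.cos (2 * Real.pi * k / 8), Real.sin (2 * Real.pi * k / 8))}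

/-- The norm whose closed unit ball is the regular octagon of inradius `1` with two sides parallel
to each coordinate axis. -/
def octagonNorm (p : ℝ × ℝ) : ℝ :=
  max (max |p.1| |p.2|) (max (|p.1 + p.2| / √2) (|p.1 - p.2| / √2))

/-- The closed ball of radius `r` around the origin for `octagonNorm`. -/
def octagonBall (r : ℝ) : Set (ℝ × ℝ) := {p | octagonNorm p ≤ r}

theorem mem_add_singleton_iff {G : Type*} [AddGroup G] {C : Set G} {x z : G} :
    z ∈ C + {x} ↔ z - x ∈ C := by
  simp [Set.add_singleton, sub_eq_add_neg]

theorem IsLattice2.image (L : (ℝ × ℝ) ≃ₗ[ℝ] (ℝ × ℝ)) {Λ : Set (ℝ × ℝ)} (h : IsLattice2 Λ) :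
    IsLattice2 (L '' Λ) := by
  obtain ⟨v, w, hvw, rfl⟩ := h
  refine ⟨L v, L w, ?_, ?_⟩
  · have := hvw.map' L.toLinearMap L.ker
    have e : (L.toLinearMap ∘ ![v, w] : Fin 2 → ℝ × ℝ) = ![L v, L w] := by
      ext i : 1
      fin_cases i <;> rfl
    rwa [e] at this
  · ext p
    constructor
    · rintro ⟨_, ⟨a, b, rfl⟩, rfl⟩
      exact ⟨a, b, by simp⟩
    · rintro ⟨a, b, rfl⟩
      exact ⟨_, ⟨a, b, rfl⟩, by simp⟩

theorem image_add_singleton (L : (ℝ × ℝ) ≃ₗ[ℝ] (ℝ × ℝ)) (C : Set (ℝ × ℝ)) (x : ℝ × ℝ) :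
    L '' C + {L x} = L '' (C + {x}) := by
  rw [Set.image_add, Set.image_singleton]

theorem IsPacking.image (L : (ℝ × ℝ) ≃ₗ[ℝ] (ℝ × ℝ)) {C Λ : Set (ℝ × ℝ)} (h : IsPacking C Λ) :
    IsPacking (L '' C) (L '' Λ) := by
  rintro _ ⟨x, hx, rfl⟩ _ ⟨y, hy, rfl⟩ hxy
  have key (s : Set (ℝ × ℝ)) : interior (L '' s) = L '' interior s :=
    (L.toContinuousLinearEquiv.toHomeomorph.image_interior s).symm
  rw [image_add_singleton, image_add_singleton, key, key, Set.disjoint_image_iff L.injective]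
  exact h hx hy (fun e => hxy (e ▸ rfl))

theorem IsCovering.image (L : (ℝ × ℝ) ≃ₗ[ℝ] (ℝ × ℝ)) {D Λ : Set (ℝ × ℝ)} (h : IsCovering D Λ) :
    IsCovering (L '' D) (L '' Λ) := by
  unfold IsCovering at *
  simp only [Set.biUnion_image, image_add_singleton]
  rw [← Set.image_iUnion₂, h, Set.image_univ, L.surjective.range_eq]

theorem gammaStar_image (L : (ℝ × ℝ) ≃ₗ[ℝ] (ℝ × ℝ)) (C : Set (ℝ × ℝ)) :
    gammaStar (L '' C) = gammaStar C := by
  have key (L : (ℝ × ℝ) ≃ₗ[ℝ] (ℝ × ℝ)) (C : Set (ℝ × ℝ)) (r : ℝ)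
      (h : ∃ Λ, IsLattice2 Λ ∧ IsPacking C Λ ∧ IsCovering (r • C) Λ) :
      ∃ Λ, IsLattice2 Λ ∧ IsPacking (L '' C) Λ ∧ IsCovering (r • (L '' C)) Λ := by
    obtain ⟨Λ, h₁, h₂, h₃⟩ := h
    refine ⟨L '' Λ, h₁.image L, h₂.image L, ?_⟩
    have e : r • (L '' C) = L '' (r • C) := (Set.image_smul_comm L r C fun b => map_smul L r b).symm
    rw [e]
    exact h₃.image L
  unfold gammaStar
  congr 1
  ext r
  refine and_congr_right fun _ => ⟨fun h => ?_, key L C r⟩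
  have := key L.symm _ r h
  rwa [← Set.image_comp, show (L.symm ∘ L : ℝ × ℝ → ℝ × ℝ) = id by ext p : 1; simp,
    Set.image_id] at this

theorem octagonNorm_le_iff {p : ℝ × ℝ} {r : ℝ} :
    octagonNorm p ≤ r ↔
      |p.1| ≤ r ∧ |p.2| ≤ r ∧ |p.1 + p.2| ≤ r * √2 ∧ |p.1 - p.2| ≤ r * √2 := by
  have h : (0 : ℝ) < √2 := by positivity
  simp only [octagonNorm, max_le_iff, div_le_iff₀ h, and_assoc]

theorem octagonNorm_lt_iff {p : ℝ × ℝ} {r : ℝ} :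
    octagonNorm p < r ↔
      |p.1| < r ∧ |p.2| < r ∧ |p.1 + p.2| < r * √2 ∧ |p.1 - p.2| < r * √2 := by
  have h : (0 : ℝ) < √2 := by positivity
  simp only [octagonNorm, max_lt_iff, div_lt_iff₀ h, and_assoc]

theorem continuous_octagonNorm : Continuous octagonNorm := by
  unfold octagonNorm
  fun_prop

theorem octagonNorm_smul (a : ℝ) (p : ℝ × ℝ) : octagonNorm (a • p) = |a| * octagonNorm p := by
  simp only [octagonNorm, Prod.smul_fst, Prod.smul_snd, smul_eq_mul, ← mul_add, ← mul_sub, abs_mul,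
    mul_div_assoc, mul_max_of_nonneg _ _ (abs_nonneg a)]

theorem octagonNorm_neg (p : ℝ × ℝ) : octagonNorm (-p) = octagonNorm p := by
  simpa using octagonNorm_smul (-1) p

theorem octagonNorm_add_le (p q : ℝ × ℝ) :
    octagonNorm (p + q) ≤ octagonNorm p + octagonNorm q := by
  obtain ⟨h₁, h₂, h₃, h₄⟩ := octagonNorm_le_iff.1 (le_refl (octagonNorm p))
  obtain ⟨k₁, k₂, k₃, k₄⟩ := octagonNorm_le_iff.1 (le_refl (octagonNorm q))
  rw [octagonNorm_le_iff, Prod.fst_add, Prod.snd_add]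
  simp only [abs_le] at *
  refine ⟨?_, ?_, ?_, ?_⟩ <;> constructor <;> linarith

theorem octagonNorm_pos {p : ℝ × ℝ} (hp : p ≠ 0) : 0 < octagonNorm p := by
  by_contra! h
  obtain ⟨h₁, h₂, -, -⟩ := octagonNorm_le_iff.1 h
  exact hp (Prod.ext (abs_nonpos_iff.1 h₁) (abs_nonpos_iff.1 h₂))

theorem smul_octagonBall {r : ℝ} (hr : 0 < r) : r • octagonBall 1 = octagonBall r := by
  ext p
  rw [Set.mem_smul_set_iff_inv_smul_mem₀ hr.ne']
  simp only [octagonBall, Set.mem_ofPred_eq, octagonNorm_smul, abs_inv, abs_of_pos hr]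
  rw [inv_mul_le_iff₀ hr, mul_one]

theorem interior_octagonBall_add_singleton (x : ℝ × ℝ) :
    interior (octagonBall 1 + {x}) = {z | octagonNorm (z - x) < 1} := by
  have hset : octagonBall 1 + {x} = {z | octagonNorm (z - x) ≤ 1} :=
    Set.ext fun z => mem_add_singleton_iff
  have hcont : Continuous fun z => octagonNorm (z - x) :=
    continuous_octagonNorm.comp (by fun_prop)
  apply Set.Subset.antisymm
  · intro z hz
    have hline : Continuous fun ε : ℝ => z + ε • (z - x) := by fun_prop
    have hmem : ∀ᶠ ε : ℝ in nhds 0, z + ε • (z - x) ∈ octagonBall 1 + {x} := by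
      apply hline.continuousAt.eventually_mem
      simpa using mem_interior_iff_mem_nhds.1 hz
    obtain ⟨ε, hε, hεpos⟩ := ((hmem.filter_mono nhdsWithin_le_nhds).and
      (self_mem_nhdsWithin : Set.Ioi (0 : ℝ) ∈ nhdsWithin 0 (Set.Ioi 0))).exists
    have : 0 < ε := hεpos
    rw [hset, Set.mem_ofPred_eq, show z + ε • (z - x) - x = (1 + ε) • (z - x) by module,
      octagonNorm_smul, abs_of_pos (by linarith)] at hε
    simp only [Set.mem_ofPred_eq]
    by_contra! h
    nlinarith
  · apply interior_maximal
    · rw [hset]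
      exact fun z hz => le_of_lt (show octagonNorm (z - x) < 1 from hz)
    · exact isOpen_lt hcont continuous_const

theorem isPacking_octagonBall_iff {Λ : Set (ℝ × ℝ)} :
    IsPacking (octagonBall 1) Λ ↔ Λ.Pairwise fun x y => 2 ≤ octagonNorm (x - y) := by
  unfold IsPacking
  simp only [interior_octagonBall_add_singleton]
  refine forall₅_congr fun x _ y _ _ => ⟨fun h => ?_, fun h => ?_⟩
  · by_contra! hlt
    have hdisj := Set.disjoint_left.1 h
    refine hdisj (a := (2⁻¹ : ℝ) • (x + y)) ?_ ?_
    · rw [Set.mem_ofPred_eq, show (2⁻¹ : ℝ) • (x + y) - x = (-2⁻¹ : ℝ) • (x - y) by module,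
        octagonNorm_smul, abs_neg, abs_of_pos (by norm_num)]
      linarith
    · rw [Set.mem_ofPred_eq, show (2⁻¹ : ℝ) • (x + y) - y = (2⁻¹ : ℝ) • (x - y) by module,
        octagonNorm_smul, abs_of_pos (by norm_num)]
      linarith
  · refine Set.disjoint_left.2 fun z hx hy => ?_
    simp only [Set.mem_ofPred_eq] at hx hy
    have := octagonNorm_add_le (z - y) (-(z - x))
    rw [octagonNorm_neg, show z - y + -(z - x) = x - y by abel] at this
    linarith

theorem isCovering_octagonBall_iff {r : ℝ} {Λ : Set (ℝ × ℝ)} :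
    IsCovering (octagonBall r) Λ ↔ ∀ z, ∃ x ∈ Λ, octagonNorm (z - x) ≤ r := by
  simp only [IsCovering, Set.eq_univ_iff_forall, Set.mem_iUnion₂, mem_add_singleton_iff,
    exists_prop]
  rfl

theorem isPreconnected_octagonNorm_eq {r : ℝ} (hr : 0 < r) :
    IsPreconnected {p | octagonNorm p = r} := by
  have hrank : 1 < Module.rank ℝ (ℝ × ℝ) := by
    rw [← Module.finrank_eq_rank]
    simp
  have hne : ∀ p ∈ Metric.sphere (0 : ℝ × ℝ) 1, p ≠ 0 := by
    rintro p hp rfl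
    simp at hp
  have himage : {p | octagonNorm p = r} =
      (fun p => (r / octagonNorm p) • p) '' Metric.sphere (0 : ℝ × ℝ) 1 := by
    ext q
    constructor
    · intro hq
      rw [Set.mem_ofPred_eq] at hq
      have hq0 : q ≠ 0 := by
        rintro rfl
        simp [octagonNorm] at hq
        exact hr.ne hq
      have hn : 0 < ‖q‖ := norm_pos_iff.2 hq0
      refine ⟨‖q‖⁻¹ • q, by simp [norm_smul, hn.ne'], ?_⟩
      simp only [octagonNorm_smul, hq, abs_inv, abs_norm, smul_smul]
      rw [show r / (‖q‖⁻¹ * r) * ‖q‖⁻¹ = 1 by field_simp, one_smul]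
    · rintro ⟨p, hp, rfl⟩
      have := octagonNorm_pos (hne p hp)
      simp only [Set.mem_ofPred_eq, octagonNorm_smul]
      rw [abs_of_pos (by positivity)]
      field_simp
  rw [himage]
  refine (isPreconnected_sphere hrank 0 1).image _ ?_
  refine ContinuousOn.smul (continuousOn_const.div continuous_octagonNorm.continuousOn ?_)
    continuousOn_id
  exact fun p hp => (octagonNorm_pos (hne p hp)).ne'

theorem IsLattice2.finite_inter_octagonBall {Λ : Set (ℝ × ℝ)} (h : IsLattice2 Λ) (R : ℝ) :
    (Λ ∩ octagonBall R).Finite := by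
  obtain ⟨v, w, hvw, rfl⟩ := h
  rw [LinearIndependent.pair_iff] at hvw
  have hdet : v.1 * w.2 - v.2 * w.1 ≠ 0 := by
    intro hd
    have h₁ := hvw w.2 (-v.2) (by ext <;> simp <;> linarith)
    have h₂ := hvw w.1 (-v.1) (by ext <;> simp <;> linarith)
    have hv : v = 0 := Prod.ext (by simpa using h₂.2) (by simpa using h₁.2)
    have := hvw 1 0 (by simp [hv])
    simp at this
  set D := v.1 * w.2 - v.2 * w.1 with hD
  have habs : 0 < |D| := abs_pos.2 hdet
  obtain ⟨n, hn⟩ := exists_nat_ge (R * (|w.1| + |w.2|) / |D|)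
  obtain ⟨m, hm⟩ := exists_nat_ge (R * (|v.1| + |v.2|) / |D|)
  rw [div_le_iff₀ habs] at hn hm
  refine (((Set.finite_Icc (-n : ℤ) n).prod (Set.finite_Icc (-m : ℤ) m)).image
    fun z : ℤ × ℤ => (z.1 : ℝ) • v + (z.2 : ℝ) • w).subset ?_
  rintro _ ⟨⟨a, b, rfl⟩, hp⟩
  obtain ⟨h₁, h₂, -, -⟩ := octagonNorm_le_iff.1 hp
  set p := (a : ℝ) • v + (b : ℝ) • w with hpdef
  have hp₁ : p.1 = a * v.1 + b * w.1 := by simp [hpdef]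
  have hp₂ : p.2 = a * v.2 + b * w.2 := by simp [hpdef]
  have bound (u : ℝ × ℝ) : |p.1 * u.2 - p.2 * u.1| ≤ R * (|u.1| + |u.2|) := by
    refine (abs_sub _ _).trans ?_
    rw [abs_mul, abs_mul]
    nlinarith [abs_nonneg u.1, abs_nonneg u.2]
  have ha : |(a : ℝ)| ≤ n := by
    refine le_of_mul_le_mul_right (le_trans ?_ hn) habs
    rw [← abs_mul, show (a : ℝ) * D = p.1 * w.2 - p.2 * w.1 by rw [hp₁, hp₂, hD]; ring]
    exact bound w
  have hb : |(b : ℝ)| ≤ m := by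
    refine le_of_mul_le_mul_right (le_trans ?_ hm) habs
    rw [← abs_mul, ← abs_neg, show -((b : ℝ) * D) = p.1 * v.2 - p.2 * v.1 by
      rw [hp₁, hp₂, hD]; ring]
    exact bound v
  rw [abs_le] at ha hb
  exact ⟨(a, b), ⟨⟨by exact_mod_cast ha.1, by exact_mod_cast ha.2⟩,
    ⟨by exact_mod_cast hb.1, by exact_mod_cast hb.2⟩⟩, rfl⟩

/-- In a lattice covering of the plane by octagons, some point lies in three of the octagons. -/
theorem exists_three_of_isCovering {r : ℝ} (hr : 0 < r) {Λ : Set (ℝ × ℝ)} (hΛ : IsLattice2 Λ)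
    (hcov : IsCovering (octagonBall r) Λ) :
    ∃ z, ∃ a ∈ Λ, ∃ b ∈ Λ, ∃ c ∈ Λ, a ≠ b ∧ b ≠ c ∧ a ≠ c ∧
      octagonNorm (z - a) ≤ r ∧ octagonNorm (z - b) ≤ r ∧ octagonNorm (z - c) ≤ r := by
  have hfin := hΛ.finite_inter_octagonBall (3 * r)
  have hzero : (0 : ℝ × ℝ) ∈ Λ := by
    obtain ⟨v, w, -, rfl⟩ := hΛ
    exact ⟨0, 0, by simp⟩
  have hneg : ∀ x ∈ Λ, -x ∈ Λ := by
    obtain ⟨v, w, -, rfl⟩ := hΛ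
    rintro _ ⟨a, b, rfl⟩
    exact ⟨-a, -b, by push_cast; module⟩
  rw [isCovering_octagonBall_iff] at hcov
  by_contra! hno
  set F := (Λ ∩ octagonBall (3 * r)) \ {0} with hF
  have hFfin : F.Finite := hfin.sdiff
  have hclosed (T : Set (ℝ × ℝ)) (hT : T ⊆ F) :
      IsClosed (⋃ x ∈ T, {z | octagonNorm (z - x) ≤ r}) :=
    (hFfin.subset hT).isClosed_biUnion fun x _ =>
      isClosed_le (continuous_octagonNorm.comp (by fun_prop)) continuous_const
  have hsphere : {q | octagonNorm q = r} ⊆ ⋃ x ∈ F, {z | octagonNorm (z - x) ≤ r} := by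
    intro q hq
    rw [Set.mem_ofPred_eq] at hq
    have hlim : Filter.Tendsto (fun ε : ℝ => (1 + ε) • q) (nhdsWithin 0 (Set.Ioi 0)) (nhds q) := by
      have : Continuous fun ε : ℝ => (1 + ε) • q := by fun_prop
      simpa using (this.tendsto 0).mono_left nhdsWithin_le_nhds
    refine (hclosed F subset_rfl).mem_of_tendsto hlim ?_
    filter_upwards [Ioo_mem_nhdsGT (zero_lt_one : (0 : ℝ) < 1)] with ε hε
    obtain ⟨x, hx, hxr⟩ := hcov ((1 + ε) • q)
    have hnorm : octagonNorm ((1 + ε) • q) = (1 + ε) * r := by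
      rw [octagonNorm_smul, hq, abs_of_pos (by linarith [hε.1])]
    refine Set.mem_iUnion₂.2 ⟨x, ⟨⟨hx, ?_⟩, ?_⟩, hxr⟩
    · have := octagonNorm_add_le ((1 + ε) • q) (-((1 + ε) • q - x))
      rw [octagonNorm_neg, hnorm, show (1 + ε) • q + -((1 + ε) • q - x) = x by abel] at this
      change octagonNorm x ≤ 3 * r
      nlinarith [hε.2]
    · rintro rfl
      rw [sub_zero, hnorm] at hxr
      nlinarith [hε.1]
  have hq₀ : octagonNorm (r, 0) = r := by
    have h := octagonNorm_smul r (1, 0)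
    have h1 : octagonNorm (1, 0) = 1 := by
      have : (√2)⁻¹ ≤ 1 := inv_le_one_of_one_le₀ (by simp)
      simpa [octagonNorm] using this
    simpa [h1, abs_of_pos hr] using h
  obtain ⟨x₀, hx₀, hq₀x⟩ := Set.mem_iUnion₂.1 (hsphere hq₀)
  have hsub : ∀ q, octagonNorm q = r → octagonNorm (q - x₀) ≤ r := by
    by_contra! hex
    obtain ⟨q₁, hq₁, hq₁x⟩ := hex
    obtain ⟨x₁, hx₁, hq₁x₁⟩ := Set.mem_iUnion₂.1 (hsphere hq₁)
    have hx₁₀ : x₁ ≠ x₀ := by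
      rintro rfl
      exact hq₁x.not_ge hq₁x₁
    obtain ⟨q, hq, hqt, hqt'⟩ := isPreconnected_closed_iff.1 (isPreconnected_octagonNorm_eq hr)
      {z | octagonNorm (z - x₀) ≤ r} (⋃ x ∈ F \ {x₀}, {z | octagonNorm (z - x) ≤ r})
      (by simpa using hclosed {x₀} (by simpa using hx₀)) (hclosed (F \ {x₀}) Set.sdiff_subset)
      (fun q hq => by
        obtain ⟨x, hx, hqx⟩ := Set.mem_iUnion₂.1 (hsphere hq)
        by_cases hxx : x = x₀
        · exact Or.inl (hxx ▸ hqx)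
        · exact Or.inr (Set.mem_iUnion₂.2 ⟨x, ⟨hx, hxx⟩, hqx⟩))
      ⟨_, hq₀, hq₀x⟩ ⟨q₁, hq₁, Set.mem_iUnion₂.2 ⟨x₁, ⟨hx₁, hx₁₀⟩, hq₁x₁⟩⟩
    obtain ⟨x, ⟨hx, hxx⟩, hqx⟩ := Set.mem_iUnion₂.1 hqt'
    have hq' : octagonNorm (q - 0) ≤ r := by
      rw [sub_zero]
      exact le_of_eq hq
    exact (hno q 0 hzero x₀ hx₀.1.1 x hx.1.1 (Ne.symm hx₀.2) (Ne.symm hxx) (Ne.symm hx.2)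
      hq' hqt).not_ge hqx
  have hx₀' : x₀ ≠ 0 := hx₀.2
  have hneg₀ : octagonNorm ((r, 0) - -x₀) ≤ r := by
    have := hsub (-(r, 0)) (by rw [octagonNorm_neg, hq₀])
    rwa [show -((r, 0) : ℝ × ℝ) - x₀ = -((r, 0) - -x₀) by abel, octagonNorm_neg] at this
  exact (hno (r, 0) 0 hzero x₀ hx₀.1.1 (-x₀) (hneg x₀ hx₀.1.1) hx₀'.symm
    (self_ne_neg.2 hx₀') (neg_ne_zero.2 hx₀').symm (by rw [sub_zero, hq₀]) hq₀x).not_ge hneg₀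

/-- Two points of an octagon of inradius less than `2 * (2 - √2)` at distance at least `2` lie
beyond the middle of opposite sides of a concentric smaller octagon. -/
theorem exists_separating_direction {a b : ℝ × ℝ} (ha : octagonNorm a < 2 * (2 - √2))
    (hb : octagonNorm b < 2 * (2 - √2)) (h : 2 ≤ octagonNorm (a - b)) :
    (2 * √2 - 2 < a.1 ∧ b.1 < -(2 * √2 - 2)) ∨ (a.1 < -(2 * √2 - 2) ∧ 2 * √2 - 2 < b.1) ∨
    (2 * √2 - 2 < a.2 ∧ b.2 < -(2 * √2 - 2)) ∨ (a.2 < -(2 * √2 - 2) ∧ 2 * √2 - 2 < b.2) ∨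
    (4 - 2 * √2 < a.1 + a.2 ∧ b.1 + b.2 < -(4 - 2 * √2)) ∨
    (a.1 + a.2 < -(4 - 2 * √2) ∧ 4 - 2 * √2 < b.1 + b.2) ∨
    (4 - 2 * √2 < a.1 - a.2 ∧ b.1 - b.2 < -(4 - 2 * √2)) ∨
    (a.1 - a.2 < -(4 - 2 * √2) ∧ 4 - 2 * √2 < b.1 - b.2) := by
  have hs : √2 * √2 = 2 := Real.mul_self_sqrt (by norm_num)
  have e : 2 * (2 - √2) * √2 = 4 * √2 - 4 := by linear_combination (-2) * hs
  rw [octagonNorm_lt_iff, e] at ha hb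
  have h' : 2 ≤ |a.1 - b.1| ∨ 2 ≤ |a.2 - b.2| ∨ 2 * √2 ≤ |(a.1 + a.2) - (b.1 + b.2)| ∨
      2 * √2 ≤ |(a.1 - a.2) - (b.1 - b.2)| := by
    contrapose! h
    rw [octagonNorm_lt_iff]
    have e₁ : (a - b).1 + (a - b).2 = (a.1 + a.2) - (b.1 + b.2) := add_sub_add_comm .. |>.symm
    have e₂ : (a - b).1 - (a - b).2 = (a.1 - a.2) - (b.1 - b.2) := sub_sub_sub_comm ..
    rw [e₁, e₂]
    exact h
  simp only [abs_lt, le_abs] at ha hb h'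
  obtain ⟨⟨_, _⟩, ⟨_, _⟩, ⟨_, _⟩, ⟨_, _⟩⟩ := ha
  obtain ⟨⟨_, _⟩, ⟨_, _⟩, ⟨_, _⟩, ⟨_, _⟩⟩ := hb
  rcases h' with (h | h) | (h | h) | (h | h) | (h | h)
  · exact Or.inl ⟨by linarith, by linarith⟩
  · exact Or.inr (Or.inl ⟨by linarith, by linarith⟩)
  · exact Or.inr (Or.inr (Or.inl ⟨by linarith, by linarith⟩))
  · exact Or.inr (Or.inr (Or.inr (Or.inl ⟨by linarith, by linarith⟩)))
  · exact Or.inr (Or.inr (Or.inr (Or.inr (Or.inl ⟨by linarith, by linarith⟩))))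
  · exact Or.inr (Or.inr (Or.inr (Or.inr (Or.inr (Or.inl ⟨by linarith, by linarith⟩)))))
  · exact Or.inr (Or.inr (Or.inr (Or.inr (Or.inr (Or.inr (Or.inl ⟨by linarith, by linarith⟩))))))
  · exact Or.inr (Or.inr (Or.inr (Or.inr (Or.inr (Or.inr (Or.inr ⟨by linarith, by linarith⟩))))))

theorem sqrt_two_bounds : 1.414 < √2 ∧ √2 < 1.415 := by
  constructor
  · rw [Real.lt_sqrt (by norm_num)]
    norm_num
  · rw [Real.sqrt_lt' (by norm_num)]
    norm_num

set_option maxHeartbeats 2000000 in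
/-- Three points at pairwise distance at least `2` do not fit in an octagon of inradius less than
`2 * (2 - √2)`. -/
theorem not_three_separated {a b c : ℝ × ℝ} (ha : octagonNorm a < 2 * (2 - √2))
    (hb : octagonNorm b < 2 * (2 - √2)) (hc : octagonNorm c < 2 * (2 - √2))
    (hab : 2 ≤ octagonNorm (a - b)) (hbc : 2 ≤ octagonNorm (b - c))
    (hac : 2 ≤ octagonNorm (a - c)) : False := by
  have h₁ := exists_separating_direction ha hb hab
  have h₂ := exists_separating_direction hb hc hbc
  have h₃ := exists_separating_direction ha hc hac
  obtain ⟨hs₁, hs₂⟩ := sqrt_two_bounds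
  have e : 2 * (2 - √2) * √2 = 4 * √2 - 4 := by
    linear_combination (-2) * Real.mul_self_sqrt (show (0 : ℝ) ≤ 2 by norm_num)
  rw [octagonNorm_lt_iff, e] at ha hb hc
  simp only [abs_lt] at ha hb hc
  obtain ⟨⟨_, _⟩, ⟨_, _⟩, ⟨_, _⟩, ⟨_, _⟩⟩ := ha
  obtain ⟨⟨_, _⟩, ⟨_, _⟩, ⟨_, _⟩, ⟨_, _⟩⟩ := hb
  obtain ⟨⟨_, _⟩, ⟨_, _⟩, ⟨_, _⟩, ⟨_, _⟩⟩ := hc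
  rcases h₁ with ⟨_, _⟩ | ⟨_, _⟩ | ⟨_, _⟩ | ⟨_, _⟩ | ⟨_, _⟩ | ⟨_, _⟩ | ⟨_, _⟩ | ⟨_, _⟩ <;>
  rcases h₂ with ⟨_, _⟩ | ⟨_, _⟩ | ⟨_, _⟩ | ⟨_, _⟩ | ⟨_, _⟩ | ⟨_, _⟩ | ⟨_, _⟩ | ⟨_, _⟩ <;>
  first
  | linarith
  | (rcases h₃ with ⟨_, _⟩ | ⟨_, _⟩ | ⟨_, _⟩ | ⟨_, _⟩ | ⟨_, _⟩ | ⟨_, _⟩ | ⟨_, _⟩ | ⟨_, _⟩ <;>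
      linarith)

theorem le_of_isCovering_octagonBall {r : ℝ} (hr : 0 < r) {Λ : Set (ℝ × ℝ)} (hΛ : IsLattice2 Λ)
    (hpack : IsPacking (octagonBall 1) Λ) (hcov : IsCovering (octagonBall r) Λ) :
    2 * (2 - √2) ≤ r := by
  rw [isPacking_octagonBall_iff] at hpack
  obtain ⟨z, a, ha, b, hb, c, hc, hab, hbc, hac, hza, hzb, hzc⟩ :=
    exists_three_of_isCovering hr hΛ hcov
  by_contra! hlt
  refine not_three_separated (hza.trans_lt hlt) (hzb.trans_lt hlt) (hzc.trans_lt hlt) ?_ ?_ ?_ <;>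
    rw [sub_sub_sub_cancel_left]
  · exact hpack hb ha hab.symm
  · exact hpack hc hb hbc.symm
  · exact hpack hc ha hac.symm

/-- The lattice attaining the simultaneous packing and covering constant of the octagon. -/
def octagonLattice : Set (ℝ × ℝ) :=
  {p | ∃ z₁ z₂ : ℤ, p = (z₁ : ℝ) • ((4 - 2 * √2, 4 * √2 - 4) : ℝ × ℝ) +
    (z₂ : ℝ) • ((8 - 4 * √2, 0) : ℝ × ℝ)}

theorem isLattice2_octagonLattice : IsLattice2 octagonLattice := by
  refine ⟨_, _, ?_, rfl⟩
  obtain ⟨hs₁, hs₂⟩ := sqrt_two_bounds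
  rw [LinearIndependent.pair_iff]
  intro s t h
  have h₁ := congrArg Prod.fst h
  have h₂ := congrArg Prod.snd h
  simp only [Prod.fst_add, Prod.snd_add, Prod.smul_fst, Prod.smul_snd, smul_eq_mul, mul_zero,
    add_zero, Prod.fst_zero, Prod.snd_zero] at h₁ h₂
  have hs : s = 0 := (mul_eq_zero.1 h₂).resolve_right (by linarith)
  rw [hs, zero_mul, zero_add] at h₁
  exact ⟨hs, (mul_eq_zero.1 h₁).resolve_right (by linarith)⟩

theorem isPacking_octagonLattice : IsPacking (octagonBall 1) octagonLattice := by
  rw [isPacking_octagonBall_iff]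
  rintro _ ⟨k₁, m₁, rfl⟩ _ ⟨k₂, m₂, rfl⟩ hne
  have hs : √2 * √2 = 2 := Real.mul_self_sqrt (by norm_num)
  obtain ⟨hs₁, hs₂⟩ := sqrt_two_bounds
  obtain ⟨k, hk⟩ : ∃ k, k = k₁ - k₂ := ⟨_, rfl⟩
  obtain ⟨n, hn⟩ : ∃ n, n = k₁ - k₂ + 2 * (m₁ - m₂) := ⟨_, rfl⟩
  have hkn : k ≠ 0 ∨ n ≠ 0 := by
    by_contra! h
    have h₁ : k₁ = k₂ := by omega
    have h₂ : m₁ = m₂ := by omega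
    exact hne (by rw [h₁, h₂])
  have hdiff : ((k₁ : ℝ) • ((4 - 2 * √2, 4 * √2 - 4) : ℝ × ℝ) +
      (m₁ : ℝ) • ((8 - 4 * √2, 0) : ℝ × ℝ)) - ((k₂ : ℝ) • ((4 - 2 * √2, 4 * √2 - 4) : ℝ × ℝ) +
      (m₂ : ℝ) • ((8 - 4 * √2, 0) : ℝ × ℝ)) = ((4 - 2 * √2) * n, (4 * √2 - 4) * k) := by
    subst hk hn
    ext <;> simp <;> ring
  rw [hdiff]
  by_contra! hlt
  obtain ⟨h₁, h₂, h₃, h₄⟩ := octagonNorm_lt_iff.1 hlt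
  simp only [abs_lt] at h₁ h₂ h₃ h₄
  have hk₁ : (k : ℝ) < 2 := by nlinarith
  have hk₂ : (-2 : ℝ) < k := by nlinarith
  have hn₁ : (n : ℝ) < 2 := by nlinarith
  have hn₂ : (-2 : ℝ) < n := by nlinarith
  norm_cast at hk₁ hn₁
  have hk₂' : -2 < k := by exact_mod_cast hk₂
  have hn₂' : -2 < n := by exact_mod_cast hn₂
  have hkc : k = -1 ∨ k = 0 ∨ k = 1 := by omega
  have hnc : n = -1 ∨ n = 0 ∨ n = 1 := by omega
  rcases hkc with rfl | rfl | rfl <;> rcases hnc with rfl | rfl | rfl <;>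
    first
    | omega
    | (push_cast at h₁ h₂ h₃ h₄; linarith)

theorem isCovering_octagonLattice : IsCovering (octagonBall (2 * (2 - √2))) octagonLattice := by
  rw [isCovering_octagonBall_iff]
  intro z
  obtain ⟨hs₁, hs₂⟩ := sqrt_two_bounds
  have e : 2 * (2 - √2) * √2 = 4 * √2 - 4 := by
    linear_combination (-2) * Real.mul_self_sqrt (show (0 : ℝ) ≤ 2 by norm_num)
  have round_bound (x h : ℝ) (hh : 0 < h) : ∃ k : ℤ, |x - k * h| ≤ h / 2 := by
    refine ⟨round (x / h), ?_⟩
    have := abs_sub_round (x / h)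
    rw [show x - round (x / h) * h = (x / h - round (x / h)) * h by field_simp, abs_mul,
      abs_of_pos hh]
    nlinarith
  obtain ⟨k, hk⟩ := round_bound z.2 (4 * √2 - 4) (by linarith)
  obtain ⟨m, hm⟩ := round_bound (z.1 - k * (4 - 2 * √2)) (8 - 4 * √2) (by linarith)
  obtain ⟨y, hy⟩ : ∃ y, y = z.2 - k * (4 * √2 - 4) := ⟨_, rfl⟩
  obtain ⟨x, hx⟩ : ∃ x, x = z.1 - k * (4 - 2 * √2) - m * (8 - 4 * √2) := ⟨_, rfl⟩
  rw [← hy] at hk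
  rw [← hx] at hm
  have shift (i j : ℤ)
      (h : octagonNorm (x - i * (4 - 2 * √2) - j * (8 - 4 * √2), y - i * (4 * √2 - 4)) ≤
        2 * (2 - √2)) : ∃ p ∈ octagonLattice, octagonNorm (z - p) ≤ 2 * (2 - √2) := by
    refine ⟨_, ⟨k + i, m + j, rfl⟩, ?_⟩
    convert h using 2
    subst hx hy
    ext <;> simp <;> ring
  rw [abs_le] at hk hm
  by_cases h : |x| + |y| ≤ 4 * √2 - 4
  · have := le_abs_self x
    have := le_abs_self y
    have := neg_abs_le x
    have := neg_abs_le y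
    apply shift 0 0
    rw [octagonNorm_le_iff, e]
    simp only [abs_le]
    push_cast
    refine ⟨⟨?_, ?_⟩, ⟨?_, ?_⟩, ⟨?_, ?_⟩, ⟨?_, ?_⟩⟩ <;> linarith
  · push Not at h
    rcases le_total 0 x with hx' | hx' <;> rcases le_total 0 y with hy' | hy' <;>
      simp only [abs_of_nonneg, abs_of_nonpos, hx', hy'] at h
    · apply shift 1 0
      rw [octagonNorm_le_iff, e]
      simp only [abs_le]
      push_cast
      refine ⟨⟨?_, ?_⟩, ⟨?_, ?_⟩, ⟨?_, ?_⟩, ⟨?_, ?_⟩⟩ <;> linarith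
    · apply shift (-1) 1
      rw [octagonNorm_le_iff, e]
      simp only [abs_le]
      push_cast
      refine ⟨⟨?_, ?_⟩, ⟨?_, ?_⟩, ⟨?_, ?_⟩, ⟨?_, ?_⟩⟩ <;> linarith
    · apply shift 1 (-1)
      rw [octagonNorm_le_iff, e]
      simp only [abs_le]
      push_cast
      refine ⟨⟨?_, ?_⟩, ⟨?_, ?_⟩, ⟨?_, ?_⟩, ⟨?_, ?_⟩⟩ <;> linarith
    · apply shift (-1) 0
      rw [octagonNorm_le_iff, e]
      simp only [abs_le]
      push_cast
      refine ⟨⟨?_, ?_⟩, ⟨?_, ?_⟩, ⟨?_, ?_⟩, ⟨?_, ?_⟩⟩ <;> linarith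

theorem gammaStar_octagonBall : gammaStar (octagonBall 1) = 2 * (2 - √2) := by
  have hpos : 0 < 2 * (2 - √2) := by linarith [sqrt_two_bounds.2]
  refine IsLeast.csInf_eq ⟨⟨hpos, octagonLattice, isLattice2_octagonLattice,
    isPacking_octagonLattice, ?_⟩, ?_⟩
  · rw [smul_octagonBall hpos]
    exact isCovering_octagonLattice
  · rintro r ⟨hr, Λ, hΛ, hpack, hcov⟩
    rw [smul_octagonBall hr] at hcov
    exact le_of_isCovering_octagonBall hr hΛ hpack hcov

theorem convex_octagonBall (r : ℝ) : Convex ℝ (octagonBall r) := by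
  intro p hp q hq a b ha hb hab
  simp only [octagonBall, Set.mem_ofPred_eq] at hp hq ⊢
  have := octagonNorm_add_le (a • p) (b • q)
  rw [octagonNorm_smul, octagonNorm_smul, abs_of_nonneg ha, abs_of_nonneg hb] at this
  have hr : r = a * r + b * r := by rw [← add_mul, hab, one_mul]
  nlinarith

/-- The rotation and scaling taking the regular octagon inscribed in the unit circle to the one of
inradius `1` with sides parallel to the coordinate axes. -/
def octagonRotation : (ℝ × ℝ) ≃ₗ[ℝ] (ℝ × ℝ) where
  toFun p := (p.1 + (√2 - 1) * p.2, p.2 - (√2 - 1) * p.1)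
  map_add' p q := by ext <;> simp <;> ring
  map_smul' a p := by ext <;> simp <;> ring
  invFun p := ((p.1 - (√2 - 1) * p.2) / (1 + (√2 - 1) ^ 2),
    (p.2 + (√2 - 1) * p.1) / (1 + (√2 - 1) ^ 2))
  left_inv p := by
    have : 1 + (√2 - 1) ^ 2 ≠ 0 := by positivity
    ext <;> simp only <;> rw [div_eq_iff this] <;> ring
  right_inv p := by
    have : 1 + (√2 - 1) ^ 2 ≠ 0 := by positivity
    ext <;> simp only <;> field_simp <;> ring

theorem octagonRotation_mem_octagonBall_iff {p : ℝ × ℝ} :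
    octagonRotation p ∈ octagonBall 1 ↔ |p.1 + (√2 - 1) * p.2| ≤ 1 ∧ |p.2 - (√2 - 1) * p.1| ≤ 1 ∧
      |(√2 - 1) * p.1 + p.2| ≤ 1 ∧ |p.1 - (√2 - 1) * p.2| ≤ 1 := by
  have hpos : (0 : ℝ) < √2 := by positivity
  have hs : √2 * √2 = 2 := Real.mul_self_sqrt (by norm_num)
  refine octagonNorm_le_iff.trans ?_
  refine and_congr Iff.rfl (and_congr Iff.rfl (and_congr ?_ ?_))
  · rw [show (octagonRotation p).1 + (octagonRotation p).2 = ((√2 - 1) * p.1 + p.2) * √2 by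
      simp only [octagonRotation, LinearEquiv.coe_mk, LinearMap.coe_mk, AddHom.coe_mk]
      linear_combination (-p.1) * hs, abs_mul, abs_of_pos hpos, mul_le_mul_iff_left₀ hpos]
  · rw [show (octagonRotation p).1 - (octagonRotation p).2 = (p.1 - (√2 - 1) * p.2) * √2 by
      simp only [octagonRotation, LinearEquiv.coe_mk, LinearMap.coe_mk, AddHom.coe_mk]
      linear_combination p.2 * hs, abs_mul, abs_of_pos hpos, mul_le_mul_iff_left₀ hpos]

theorem octagon_vertices : {p : ℝ × ℝ | ∃ k : Fin 8,
    p = (Real.cos (2 * Real.pi * k / 8), Real.sin (2 * Real.pi * k / 8))} =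
    {(1, 0), (√2 / 2, √2 / 2), (0, 1), (-(√2 / 2), √2 / 2), (-1, 0), (-(√2 / 2), -(√2 / 2)),
      (0, -1), (√2 / 2, -(√2 / 2))} := by
  have h₁ : 2 * Real.pi / 8 = Real.pi / 4 := by ring
  have h₂ : 2 * Real.pi * 2 / 8 = Real.pi / 2 := by ring
  have h₃ : 2 * Real.pi * 3 / 8 = Real.pi - Real.pi / 4 := by ring
  have h₄ : 2 * Real.pi * 4 / 8 = Real.pi := by ring
  have h₅ : 2 * Real.pi * 5 / 8 = Real.pi / 4 + Real.pi := by ring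
  have h₆ : 2 * Real.pi * 6 / 8 = Real.pi / 2 + Real.pi := by ring
  have h₇ : 2 * Real.pi * 7 / 8 = 2 * Real.pi - Real.pi / 4 := by ring
  ext p
  simp only [Set.mem_ofPred_eq, Fin.exists_fin_succ, Set.mem_insert_iff, Set.mem_singleton_iff]
  simp [h₁, h₂, h₃, h₄, h₅, h₆, h₇, Real.cos_pi_sub, Real.sin_pi_sub,
    Real.cos_add_pi, Real.sin_add_pi, Real.cos_two_pi_sub, Real.sin_two_pi_sub]

theorem Convex.smul_add_smul_mem_of_zero_mem {E : Type*} [AddCommGroup E] [Module ℝ E] {S : Set E}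
    (hS : Convex ℝ S) (h0 : 0 ∈ S) {u v : E} (hu : u ∈ S) (hv : v ∈ S) {a b : ℝ} (ha : 0 ≤ a)
    (hb : 0 ≤ b) (hab : a + b ≤ 1) : a • u + b • v ∈ S := by
  rcases (add_nonneg ha hb).eq_or_lt with h | h
  · rw [show a = 0 by linarith, show b = 0 by linarith]
    simpa using h0
  · have := hS.smul_mem_of_zero_mem h0 (hS hu hv (div_nonneg ha h.le) (div_nonneg hb h.le)
      (by field_simp)) ⟨h.le, hab⟩
    rwa [smul_add, smul_smul, smul_smul, mul_div_cancel₀ _ h.ne', mul_div_cancel₀ _ h.ne'] at this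

theorem mem_regularOctagon_iff {p : ℝ × ℝ} :
    p ∈ regularOctagon ↔ octagonRotation p ∈ octagonBall 1 := by
  have hs : √2 * √2 = 2 := Real.mul_self_sqrt (by norm_num)
  obtain ⟨hs₁, hs₂⟩ := sqrt_two_bounds
  rw [regularOctagon, octagon_vertices]
  constructor
  · have hconv : Convex ℝ (octagonRotation ⁻¹' octagonBall 1) :=
      (convex_octagonBall 1).linear_preimage octagonRotation.toLinearMap
    refine fun hp => convexHull_min ?_ hconv hp
    intro q hq
    rw [Set.mem_preimage, octagonRotation_mem_octagonBall_iff]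
    simp only [Set.mem_insert_iff, Set.mem_singleton_iff] at hq
    simp only [abs_le]
    rcases hq with rfl | rfl | rfl | rfl | rfl | rfl | rfl | rfl <;>
      refine ⟨⟨?_, ?_⟩, ⟨?_, ?_⟩, ⟨?_, ?_⟩, ⟨?_, ?_⟩⟩ <;> simp only <;> nlinarith
  · rw [octagonRotation_mem_octagonBall_iff]
    simp only [abs_le]
    rintro ⟨⟨_, _⟩, ⟨_, _⟩, ⟨_, _⟩, ⟨_, _⟩⟩
    set V : Set (ℝ × ℝ) := {(1, 0), (√2 / 2, √2 / 2), (0, 1), (-(√2 / 2), √2 / 2), (-1, 0),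
      (-(√2 / 2), -(√2 / 2)), (0, -1), (√2 / 2, -(√2 / 2))} with hV
    have hconv := convex_convexHull ℝ V
    have hvert : ∀ v ∈ V, v ∈ convexHull ℝ V := subset_convexHull ℝ V
    have h0 : (0 : ℝ × ℝ) ∈ convexHull ℝ V := by
      have := hconv (hvert (1, 0) (by simp [hV])) (hvert (-1, 0) (by simp [hV]))
        (show (0 : ℝ) ≤ 1 / 2 by norm_num) (show (0 : ℝ) ≤ 1 / 2 by norm_num) (by norm_num)
      simpa [← Prod.zero_eq_mk] using this
    have key (u : ℝ × ℝ) (e₁ e₂ a t : ℝ) (hu : u ∈ V) (hv : (e₁ * (√2 / 2), e₂ * (√2 / 2)) ∈ V)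
        (ha : 0 ≤ a) (ht : 0 ≤ t) (hat : a + √2 * t ≤ 1) (h₁ : p.1 = a * u.1 + t * e₁)
        (h₂ : p.2 = a * u.2 + t * e₂) : p ∈ convexHull ℝ V := by
      have hp : p = a • u + (√2 * t) • (e₁ * (√2 / 2), e₂ * (√2 / 2)) := by
        ext
        · simp only [Prod.fst_add, Prod.smul_fst, smul_eq_mul]
          linear_combination h₁ - t * e₁ / 2 * hs
        · simp only [Prod.snd_add, Prod.smul_snd, smul_eq_mul]
          linear_combination h₂ - t * e₂ / 2 * hs
      rw [hp]
      exact hconv.smul_add_smul_mem_of_zero_mem h0 (hvert _ hu) (hvert _ hv) ha (by positivity) hat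
    rcases le_total 0 p.1 with hx | hx <;> rcases le_total 0 p.2 with hy | hy
    · rcases le_total p.1 p.2 with h | h
      · refine key (0, 1) 1 1 (p.2 - p.1) p.1 (by simp [hV]) (by simp [hV])
          ?_ ?_ ?_ ?_ ?_ <;>
          linarith
      · refine key (1, 0) 1 1 (p.1 - p.2) p.2 (by simp [hV]) (by simp [hV])
          ?_ ?_ ?_ ?_ ?_ <;>
          linarith
    · rcases le_total p.1 (-p.2) with h | h
      · refine key (0, -1) 1 (-1) (-p.2 - p.1) p.1 (by simp [hV]) (by simp [hV])
          ?_ ?_ ?_ ?_ ?_ <;>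
          linarith
      · refine key (1, 0) 1 (-1) (p.1 + p.2) (-p.2) (by simp [hV]) (by simp [hV])
          ?_ ?_ ?_ ?_ ?_ <;>
          linarith
    · rcases le_total (-p.1) p.2 with h | h
      · refine key (0, 1) (-1) 1 (p.2 + p.1) (-p.1) (by simp [hV]) (by simp [hV])
          ?_ ?_ ?_ ?_ ?_ <;>
          linarith
      · refine key (-1, 0) (-1) 1 (-p.1 - p.2) p.2 (by simp [hV]) (by simp [hV])
          ?_ ?_ ?_ ?_ ?_ <;>
          linarith
    · rcases le_total (-p.1) (-p.2) with h | h
      · refine key (0, -1) (-1) (-1) (-p.2 + p.1) (-p.1) (by simp [hV]) (by simp [hV])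
          ?_ ?_ ?_ ?_ ?_ <;>
          linarith
      · refine key (-1, 0) (-1) (-1) (-p.1 + p.2) (-p.2) (by simp [hV]) (by simp [hV])
          ?_ ?_ ?_ ?_ ?_ <;>
          linarith

theorem regularOctagon_eq : regularOctagon = octagonRotation.symm '' octagonBall 1 := by
  ext p
  rw [LinearEquiv.image_symm_eq_preimage, Set.mem_preimage, mem_regularOctagon_iff]

/-- If `P₈` is an affinely regular octagon centered at the origin, i.e. the image of
a regular octagon under an invertible linear map, then `γ*(P₈) = 2(2 − √2)`. -/
theorem gammaStar_octagon (P₈ : Set (ℝ × ℝ))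
    (hP : ∃ L : (ℝ × ℝ) ≃ₗ[ℝ] (ℝ × ℝ), P₈ = L '' regularOctagon) :
    gammaStar P₈ = 2 * (2 - Real.sqrt 2) := by
  obtain ⟨L, rfl⟩ := hP
  rw [gammaStar_image, regularOctagon_eq, gammaStar_image, gammaStar_octagonBall]
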